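/- Classification of elements, μ > 4 case (Theorem 3.5 via the Thurston representation). Let s > 2 be a real number and let G ≤ SL(2,ℝ) be the subgroup generated by A(s) and B(s). Then for every g ∈ G: |tr g| > 2 (i.e., g is hyperbolic, corresponding to a pseudo-Anosov mapping class) if and only if there do NOT exist h ∈ G and k ∈ ℤ with h·g·h⁻¹ = A(s)^k or h·g·h⁻¹ = B(s)^k. -/

import Mathlib

open Matrix

noncomputable section

abbrev SL2R := Matrix.SpecialLinearGroup (Fin 2) ℝ

/-- The matrix `A(s) = [[1, -s], [0, 1]]` of Thurston's construction. -/
def Amat (s : ℝ) : SL2R := ⟨!![1, -s; 0, 1], by simp [Matrix.det_fin_two_of]⟩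

/-- The matrix `B(s) = [[1, 0], [s, 1]]` of Thurston's construction. -/
def Bmat (s : ℝ) : SL2R := ⟨!![1, 0; s, 1], by simp [Matrix.det_fin_two_of]⟩

theorem SL_val_mul (M N : SL2R) : (M * N).1 = M.1 * N.1 := rfl

theorem SL_val_one : (1 : SL2R).1 = 1 := rfl

theorem Amat_zpow (s : ℝ) (k : ℤ) : ((Amat s) ^ k).1 = !![1, -(k * s); 0, 1] := by
  have key : ∀ t : ℝ, ∀ n : ℕ, ((Amat t) ^ n).1 = !![1, -(n * t); 0, 1] := by
    intro t n
    induction n with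
    | zero => simp [Matrix.one_fin_two]
    | succ n ih =>
      rw [pow_succ, SL_val_mul, ih]
      simp [Amat, Matrix.mul_fin_two]
      ring
  have hinv : (Amat s)⁻¹ = Amat (-s) := by
    rw [inv_eq_iff_mul_eq_one]
    apply Subtype.ext
    rw [SL_val_mul, SL_val_one]
    simp [Amat, Matrix.mul_fin_two, Matrix.one_fin_two]
  rcases Int.eq_nat_or_neg k with ⟨n, rfl | rfl⟩
  · rw [zpow_natCast, key]; simp
  · rw [_root_.zpow_neg, zpow_natCast, ← inv_pow, hinv, key]; simp

theorem Bmat_zpow (s : ℝ) (k : ℤ) : ((Bmat s) ^ k).1 = !![1, 0; k * s, 1] := by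
  have key : ∀ t : ℝ, ∀ n : ℕ, ((Bmat t) ^ n).1 = !![1, 0; n * t, 1] := by
    intro t n
    induction n with
    | zero => simp [Matrix.one_fin_two]
    | succ n ih =>
      rw [pow_succ, SL_val_mul, ih]
      simp [Bmat, Matrix.mul_fin_two]
      ring
  have hinv : (Bmat s)⁻¹ = Bmat (-s) := by
    rw [inv_eq_iff_mul_eq_one]
    apply Subtype.ext
    rw [SL_val_mul, SL_val_one]
    simp [Bmat, Matrix.mul_fin_two, Matrix.one_fin_two]
  rcases Int.eq_nat_or_neg k with ⟨n, rfl | rfl⟩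
  · rw [zpow_natCast, key]; simp
  · rw [_root_.zpow_neg, zpow_natCast, ← inv_pow, hinv, key]; simp

/-- `M` maps the cone `|y| ≤ |x|` strictly inside itself. -/
def ConeMap (M : SL2R) : Prop :=
  ∀ x y : ℝ, |y| ≤ |x| → x ≠ 0 →
    |M.1 1 0 * x + M.1 1 1 * y| < |M.1 0 0 * x + M.1 0 1 * y|

theorem ConeMap.mul {M N : SL2R} (hM : ConeMap M) (hN : ConeMap N) : ConeMap (M * N) := by
  intro x y h hx
  have h1 := hN x y h hx
  have h2 := hM _ _ h1.le (by
    intro h0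
    rw [h0, abs_zero] at h1
    exact absurd h1 (not_lt.mpr (abs_nonneg _)))
  rw [SL_val_mul]
  simp only [Matrix.mul_apply, Fin.sum_univ_two]
  convert h2 using 2 <;> ring

theorem abs_shear {c x y : ℝ} (hc : 2 < |c|) (h : |y| ≤ |x|) (hx : x ≠ 0) :
    |x| < |c * x + y| := by
  have h1 : |c * x| ≤ |c * x + y| + |y| := by
    have := abs_sub (c * x + y) y
    simpa using this
  rw [abs_mul] at h1
  have : 0 < |x| := abs_pos.mpr hx
  nlinarith

theorem abs_int_mul {s : ℝ} (hs : 2 < s) {k : ℤ} (hk : k ≠ 0) : 2 < |(k : ℝ) * s| := by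
  rw [abs_mul, abs_of_pos (by linarith : (0 : ℝ) < s)]
  have : (1 : ℝ) ≤ |(k : ℝ)| := by exact_mod_cast Int.one_le_abs hk
  nlinarith

theorem ConeMap_AB {s : ℝ} (hs : 2 < s) {a b : ℤ} (ha : a ≠ 0) (hb : b ≠ 0) :
    ConeMap ((Amat s) ^ a * (Bmat s) ^ b) := by
  intro x y h hx
  have h1 := abs_shear (abs_int_mul hs hb) h hx
  have hy : (b : ℝ) * s * x + y ≠ 0 := by
    intro h0
    rw [h0, abs_zero] at h1
    exact absurd h1 (not_lt.mpr (abs_nonneg _))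
  have h2 := abs_shear (c := -(a * s)) (by rw [abs_neg]; exact abs_int_mul hs ha) h1.le hy
  rw [SL_val_mul, Amat_zpow, Bmat_zpow]
  simp only [Matrix.mul_fin_two]
  simp
  convert h2 using 2
  ring

theorem ConeMap.trace {M : SL2R} (hM : ConeMap M) : 2 < |Matrix.trace M.1| := by
  have hdet : M.1 0 0 * M.1 1 1 - M.1 0 1 * M.1 1 0 = 1 := by
    rw [← Matrix.det_fin_two]; exact M.2
  rw [Matrix.trace_fin_two]
  have h1 := hM 1 1 (by simp) (by simp)
  have h2 := hM 1 (-1) (by simp) (by simp)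
  have h3 : |M.1 0 1| < |M.1 0 0| := by
    by_contra! h
    by_cases hq : M.1 0 1 = 0
    · have h0 := hM 1 0 (by simp) (by simp)
      rw [hq, abs_zero] at h
      have : |M.1 0 0| = 0 := le_antisymm h (abs_nonneg _)
      simp [hq, this] at h0
      exact absurd h0 (not_lt.mpr (abs_nonneg _))
    · have h0 := hM (M.1 0 1) (-M.1 0 0) (by simpa using h) hq
      rw [show M.1 0 0 * M.1 0 1 + M.1 0 1 * -M.1 0 0 = 0 by ring, abs_zero] at h0
      exact absurd h0 (not_lt.mpr (abs_nonneg _))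
  generalize M.1 0 0 = p at *
  generalize M.1 0 1 = q at *
  generalize M.1 1 0 = r at *
  generalize M.1 1 1 = t at *
  have key : |q - r| < |p - t| := by
    rcases lt_abs.mp ((abs_nonneg q).trans_lt h3) with hp | hp
    · rw [abs_of_pos hp] at h3
      have := abs_lt.mp h3
      rw [abs_of_pos (by linarith : 0 < p * 1 + q * 1)] at h1
      rw [abs_of_pos (by linarith : 0 < p * 1 + q * -1)] at h2
      have := abs_lt.mp h1
      have := abs_lt.mp h2
      refine lt_of_lt_of_le ?_ (le_abs_self _)
      rw [abs_lt]; constructor <;> linarith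
    · rw [abs_of_neg (by linarith : p < 0)] at h3
      have := abs_lt.mp h3
      rw [abs_of_neg (by linarith : p * 1 + q * 1 < 0)] at h1
      rw [abs_of_neg (by linarith : p * 1 + q * -1 < 0)] at h2
      have := abs_lt.mp h1
      have := abs_lt.mp h2
      refine lt_of_lt_of_le ?_ (neg_le_abs _)
      rw [abs_lt]; constructor <;> linarith
  have k2 := sq_lt_sq.mpr key
  have : (2 : ℝ) ^ 2 < (p + t) ^ 2 := by nlinarith [sq_nonneg (q + r)]
  simpa using sq_lt_sq.mp this

/-- The product of the syllables `A^a B^b`. -/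
def wd (s : ℝ) (l : List (ℤ × ℤ)) : SL2R :=
  (l.map fun p => (Amat s) ^ p.1 * (Bmat s) ^ p.2).prod

theorem wd_append (s : ℝ) (l m : List (ℤ × ℤ)) : wd s (l ++ m) = wd s l * wd s m := by
  simp [wd]

theorem wd_cons (s : ℝ) (p : ℤ × ℤ) (m : List (ℤ × ℤ)) :
    wd s (p :: m) = (Amat s) ^ p.1 * (Bmat s) ^ p.2 * wd s m := by
  simp [wd]

theorem wd_nil (s : ℝ) : wd s [] = 1 := by simp [wd]

theorem A_mem (s : ℝ) : Amat s ∈ Subgroup.closure {Amat s, Bmat s} :=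
  Subgroup.subset_closure (by simp)

theorem B_mem (s : ℝ) : Bmat s ∈ Subgroup.closure {Amat s, Bmat s} :=
  Subgroup.subset_closure (by simp)

theorem wd_mem (s : ℝ) (l : List (ℤ × ℤ)) : wd s l ∈ Subgroup.closure {Amat s, Bmat s} := by
  induction l with
  | nil => rw [wd_nil]; exact one_mem _
  | cons p l ih =>
    rw [wd_cons]
    exact mul_mem (mul_mem (zpow_mem (A_mem s) _) (zpow_mem (B_mem s) _)) ih

theorem exists_wd (s : ℝ) (g : SL2R) (hg : g ∈ Subgroup.closure {Amat s, Bmat s}) :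
    ∃ l, g = wd s l := by
  induction hg using Subgroup.closure_induction_left with
  | one => exact ⟨[], (wd_nil s).symm⟩
  | mul_left x hx y hy ih =>
    obtain ⟨l, rfl⟩ := ih
    rcases hx with rfl | rfl
    · exact ⟨(1, 0) :: l, by simp [wd_cons]⟩
    · exact ⟨(0, 1) :: l, by simp [wd_cons]⟩
  | inv_mul_cancel x hx y hy ih =>
    obtain ⟨l, rfl⟩ := ih
    rcases hx with rfl | rfl
    · exact ⟨(-1, 0) :: l, by simp [wd_cons]⟩
    · exact ⟨(0, -1) :: l, by simp [wd_cons]⟩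

theorem ConeMap_wd {s : ℝ} (hs : 2 < s) (l : List (ℤ × ℤ)) (hl : l ≠ [])
    (h : ∀ p ∈ l, p.1 ≠ 0 ∧ p.2 ≠ 0) : ConeMap (wd s l) := by
  induction l with
  | nil => exact absurd rfl hl
  | cons p l ih =>
    rw [wd_cons]
    have hp := h p (by simp)
    have h1 := ConeMap_AB hs hp.1 hp.2
    by_cases h0 : l = []
    · subst h0; rw [wd_nil, mul_one]; exact h1
    · exact h1.mul (ih h0 fun q hq => h q (by simp [hq]))

theorem wd_class {s : ℝ} (hs : 2 < s) (n : ℕ) : ∀ l : List (ℤ × ℤ), l.length = n →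
    ∃ h ∈ Subgroup.closure {Amat s, Bmat s},
      ((∃ k : ℤ, h * wd s l * h⁻¹ = (Amat s) ^ k ∨ h * wd s l * h⁻¹ = (Bmat s) ^ k) ∨
        ConeMap (h * wd s l * h⁻¹)) := by
  induction n using Nat.strong_induction_on with
  | _ n ih =>
  intro l hln
  by_cases hl : l = []
  · subst hl
    exact ⟨1, one_mem _, Or.inl ⟨0, Or.inl (by simp [wd_nil])⟩⟩
  by_cases hall : ∀ p ∈ l, p.1 ≠ 0 ∧ p.2 ≠ 0
  · exact ⟨1, one_mem _, Or.inr (by simpa using ConeMap_wd hs l hl hall)⟩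
  push Not at hall
  obtain ⟨⟨a, b⟩, hp, hab⟩ := hall
  -- it is enough to find a shorter conjugate word
  have red : ∀ l' : List (ℤ × ℤ), l'.length < n →
      ∀ c ∈ Subgroup.closure {Amat s, Bmat s}, wd s l' = c * wd s l * c⁻¹ →
      ∃ h ∈ Subgroup.closure {Amat s, Bmat s},
      ((∃ k : ℤ, h * wd s l * h⁻¹ = (Amat s) ^ k ∨ h * wd s l * h⁻¹ = (Bmat s) ^ k) ∨
        ConeMap (h * wd s l * h⁻¹)) := by
    intro l' hl' c hc hcl
    obtain ⟨h, hh, H⟩ := ih _ hl' l' rfl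
    refine ⟨h * c, mul_mem hh hc, ?_⟩
    have : h * c * wd s l * (h * c)⁻¹ = h * wd s l' * h⁻¹ := by rw [hcl]; group
    rw [this]
    exact H
  obtain ⟨l1, l2, rfl⟩ := List.append_of_mem hp
  have hlen : l1.length + l2.length + 1 = n := by
    rw [← hln]; simp; omega
  have hab' : a = 0 ∨ b = 0 := by
    by_cases h : a = 0
    · exact Or.inl h
    · exact Or.inr (hab h)
  rcases List.eq_nil_or_concat' (l2 ++ l1) with h0 | ⟨m, ⟨c, d⟩, hm⟩
  · obtain ⟨rfl, rfl⟩ := List.append_eq_nil_iff.mp h0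
    refine ⟨1, one_mem _, Or.inl ?_⟩
    rcases hab' with rfl | rfl
    · exact ⟨b, Or.inr (by simp [wd_cons, wd_nil])⟩
    · exact ⟨a, Or.inl (by simp [wd_cons, wd_nil])⟩
  · rcases hab' with rfl | rfl
    · have hmw := congrArg (wd s) hm
      have hml := congrArg List.length hm
      simp at hml
      refine red (m ++ [(c, d + b)]) (by simp; omega) (wd s l2) (wd_mem s l2) ?_
      have e : wd s (m ++ [(c, d + b)]) = wd s (m ++ [(c, d)]) * (Bmat s) ^ b := by
        simp [wd_append, wd_cons, wd_nil, _root_.zpow_add, mul_assoc]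
      rw [e, ← hmw]
      simp [wd_append, wd_cons, mul_assoc]
    · cases hq : l2 ++ l1 with
      | nil => simp [hq] at hm
      | cons q m' =>
        have hmw := congrArg (wd s) hq
        have hml := congrArg List.length hq
        simp at hml
        refine red ((a + q.1, q.2) :: m') (by simp; omega) (wd s l1)⁻¹
          (inv_mem (wd_mem s l1)) ?_
        have e : wd s ((a + q.1, q.2) :: m') = (Amat s) ^ a * wd s (q :: m') := by
          simp [wd_cons, _root_.zpow_add, mul_assoc]
        rw [e, ← hmw]
        simp [wd_append, wd_cons, mul_assoc]

theorem trace_conj_SL (h g : SL2R) : Matrix.trace (h * g * h⁻¹).1 = Matrix.trace g.1 := by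
  rw [SL_val_mul, Matrix.trace_mul_comm, ← SL_val_mul]
  simp [← mul_assoc]

/-- Theorem 3.5, case `μ > 4`, via the Thurston representation:
for `s > 2`, an element `g` of the group generated by `A(s)` and `B(s)` is hyperbolic
iff no conjugate of `g` within the group is a power of `A(s)` or of `B(s)`. -/
theorem classification_mu_gt_four
    (s : ℝ) (hs : 2 < s)
    (g : SL2R) (hg : g ∈ Subgroup.closure {Amat s, Bmat s}) :
    2 < |Matrix.trace g.1| ↔
      ¬ ∃ h ∈ Subgroup.closure {Amat s, Bmat s}, ∃ k : ℤ,
          h * g * h⁻¹ = (Amat s) ^ k ∨ h * g * h⁻¹ = (Bmat s) ^ k := by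
  constructor
  · rintro ht ⟨h, -, k, hk | hk⟩
    · rw [← trace_conj_SL h g, hk, Amat_zpow, Matrix.trace_fin_two] at ht
      norm_num at ht
    · rw [← trace_conj_SL h g, hk, Bmat_zpow, Matrix.trace_fin_two] at ht
      norm_num at ht
  · intro hn
    obtain ⟨l, rfl⟩ := exists_wd s g hg
    obtain ⟨h, hh, H | H⟩ := wd_class hs _ l rfl
    · exact absurd ⟨h, hh, H⟩ hn
    · rw [← trace_conj_SL h]
      exact H.trace
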